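/- arXiv:2310.07196 — 3 statements merged into one kernel-verified Lean document; each statement's English description precedes it below -/
import Mathlib

section
/- A norm ‖·‖ on the real vector space H_n of n×n complex Hermitian matrices is weakly unitarily invariant if and only if there exists a symmetric norm f : ℝ^n → ℝ such that ‖A‖ = f(λ(A)) for every A ∈ H_n, where λ(A) is the vector of eigenvalues of A listed in nonincreasing order. -/
open MeasureTheory ProbabilityTheory Matrix

/-- The eigenvalues of a Hermitian matrix, listed in nonincreasing order. -/
noncomputable def eigVec {n : ℕ} {A : Matrix (Fin n) (Fin n) ℂ} (hA : A.IsHermitian) :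
    Fin n → ℝ :=
  fun i => hA.eigenvalues (Tuple.sort hA.eigenvalues i.rev)

/-- `N` is a norm on the real vector space of `n × n` complex Hermitian matrices. -/
def IsNormOnHermitian {n : ℕ} (N : Matrix (Fin n) (Fin n) ℂ → ℝ) : Prop :=
  (∀ A : Matrix (Fin n) (Fin n) ℂ, A.IsHermitian → (N A = 0 ↔ A = 0)) ∧
  (∀ (c : ℝ) (A : Matrix (Fin n) (Fin n) ℂ), A.IsHermitian → N (c • A) = |c| * N A) ∧
  (∀ A B : Matrix (Fin n) (Fin n) ℂ, A.IsHermitian → B.IsHermitian → N (A + B) ≤ N A + N B)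

/-- `N` is weakly unitarily invariant on Hermitian matrices. -/
def IsWeaklyUnitarilyInvariant {n : ℕ} (N : Matrix (Fin n) (Fin n) ℂ → ℝ) : Prop :=
  ∀ A : Matrix (Fin n) (Fin n) ℂ, A.IsHermitian →
    ∀ U : Matrix (Fin n) (Fin n) ℂ, U ∈ Matrix.unitaryGroup (Fin n) ℂ →
      N (Uᴴ * A * U) = N A

/-- `f` is a symmetric norm on `ℝⁿ`. -/
def IsSymmetricNorm {n : ℕ} (f : (Fin n → ℝ) → ℝ) : Prop :=
  (∀ x : Fin n → ℝ, f x = 0 ↔ x = 0) ∧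
  (∀ (c : ℝ) (x : Fin n → ℝ), f (c • x) = |c| * f x) ∧
  (∀ x y : Fin n → ℝ, f (x + y) ≤ f x + f y) ∧
  (∀ (σ : Equiv.Perm (Fin n)) (x : Fin n → ℝ), f (x ∘ σ) = f x)

/-- The permutation matrix of `σ`, as the identity with reindexed columns, is unitary. -/
lemma one_submatrix_perm_mem_unitaryGroup {n : ℕ} (σ : Equiv.Perm (Fin n)) :
    (1 : Matrix (Fin n) (Fin n) ℂ).submatrix id σ ∈ Matrix.unitaryGroup (Fin n) ℂ := by
  rw [Matrix.mem_unitaryGroup_iff', star_eq_conjTranspose, conjTranspose_submatrix,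
    conjTranspose_one, submatrix_mul _ _ _ _ _ Function.bijective_id |>.symm, mul_one,
    submatrix_one_equiv]

lemma conjTranspose_one_submatrix_perm_mul_diagonal_mul {n : ℕ} (σ : Equiv.Perm (Fin n))
    (d : Fin n → ℂ) :
    ((1 : Matrix (Fin n) (Fin n) ℂ).submatrix id σ)ᴴ * diagonal d *
      (1 : Matrix (Fin n) (Fin n) ℂ).submatrix id σ = diagonal (d ∘ σ) := by
  rw [conjTranspose_submatrix, conjTranspose_one, ← submatrix_diagonal_equiv d σ,
    ← submatrix_id_id (diagonal d), ← submatrix_mul _ _ _ _ _ Function.bijective_id,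
    ← submatrix_mul _ _ _ _ _ Function.bijective_id, one_mul, mul_one, submatrix_submatrix]
  rfl

lemma isHermitian_diagonal_ofReal {n : ℕ} (x : Fin n → ℝ) :
    (diagonal (fun i => (x i : ℂ))).IsHermitian :=
  isHermitian_diagonal_of_self_adjoint _ (funext fun i => Complex.conj_ofReal (x i))

lemma eigVec_eq_comp_perm {n : ℕ} {A : Matrix (Fin n) (Fin n) ℂ} (hA : A.IsHermitian) :
    eigVec hA = hA.eigenvalues ∘ (Fin.revPerm.trans (Tuple.sort hA.eigenvalues)) :=
  rfl

/-- A weakly unitarily invariant function takes the same value at a Hermitian matrix and at the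
diagonal matrix of its eigenvalues. -/
lemma IsWeaklyUnitarilyInvariant.apply_diagonal_eigenvalues {n : ℕ}
    {N : Matrix (Fin n) (Fin n) ℂ → ℝ} (hW : IsWeaklyUnitarilyInvariant N)
    {A : Matrix (Fin n) (Fin n) ℂ} (hA : A.IsHermitian) :
    N (diagonal fun i => (hA.eigenvalues i : ℂ)) = N A := by
  have h := hA.conjStarAlgAut_star_eigenvectorUnitary
  rw [Unitary.conjStarAlgAut_star_apply] at h
  rw [← hW A hA _ hA.eigenvectorUnitary.2]
  exact congrArg N h.symm

/-- A weakly unitarily invariant function on diagonal matrices is symmetric in the entries. -/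
lemma IsWeaklyUnitarilyInvariant.apply_diagonal_comp_perm {n : ℕ}
    {N : Matrix (Fin n) (Fin n) ℂ → ℝ} (hW : IsWeaklyUnitarilyInvariant N)
    (σ : Equiv.Perm (Fin n)) (x : Fin n → ℝ) :
    N (diagonal fun i => ((x ∘ σ) i : ℂ)) = N (diagonal fun i => (x i : ℂ)) := by
  rw [← hW _ (isHermitian_diagonal_ofReal x) _ (one_submatrix_perm_mem_unitaryGroup σ),
    conjTranspose_one_submatrix_perm_mul_diagonal_mul]
  rfl

lemma IsWeaklyUnitarilyInvariant.isSymmetricNorm_diagonal {n : ℕ}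
    {N : Matrix (Fin n) (Fin n) ℂ → ℝ} (hN : IsNormOnHermitian N)
    (hW : IsWeaklyUnitarilyInvariant N) :
    IsSymmetricNorm fun x : Fin n → ℝ => N (diagonal fun i => (x i : ℂ)) := by
  obtain ⟨h0, hs, ha⟩ := hN
  refine ⟨fun x => ?_, fun c x => ?_, fun x y => ?_, hW.apply_diagonal_comp_perm⟩
  · rw [h0 _ (isHermitian_diagonal_ofReal x), diagonal_eq_zero, funext_iff, funext_iff]
    simp
  · rw [← hs c _ (isHermitian_diagonal_ofReal x), ← diagonal_smul]
    refine congrArg (fun d => N (diagonal d)) (funext fun i => ?_)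
    simp
  · convert ha _ _ (isHermitian_diagonal_ofReal x) (isHermitian_diagonal_ofReal y) using 2
    rw [diagonal_add]
    simp

lemma eigVec_conjTranspose_mul_mul {n : ℕ} {A U : Matrix (Fin n) (Fin n) ℂ}
    (hA : A.IsHermitian) (hU : U ∈ Matrix.unitaryGroup (Fin n) ℂ)
    (hB : (Uᴴ * A * U).IsHermitian) : eigVec hB = eigVec hA := by
  have hUU : U * Uᴴ = 1 := Matrix.mem_unitaryGroup_iff.mp hU
  have h : hB.eigenvalues = hA.eigenvalues := by
    rw [Matrix.IsHermitian.eigenvalues_eq_eigenvalues_iff, charpoly_mul_comm, ← mul_assoc, hUU,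
      one_mul]
  unfold eigVec
  rw [h]

/-- A norm on the Hermitian matrices is weakly unitarily invariant if and only if it is a
symmetric norm applied to the vector of eigenvalues in nonincreasing order. -/
theorem weaklyUnitarilyInvariant_iff_symmetricNorm_eigenvalues
    {n : ℕ} (N : Matrix (Fin n) (Fin n) ℂ → ℝ) (hN : IsNormOnHermitian N) :
    IsWeaklyUnitarilyInvariant N ↔
      ∃ f : (Fin n → ℝ) → ℝ, IsSymmetricNorm f ∧
        ∀ (A : Matrix (Fin n) (Fin n) ℂ) (hA : A.IsHermitian), N A = f (eigVec hA) := by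
  refine ⟨fun hW => ⟨_, hW.isSymmetricNorm_diagonal hN, fun A hA => ?_⟩, ?_⟩
  · rw [eigVec_eq_comp_perm, hW.apply_diagonal_comp_perm, hW.apply_diagonal_eigenvalues]
  · rintro ⟨f, -, hf⟩ A hA U hU
    have hB : (Uᴴ * A * U).IsHermitian := isHermitian_conjTranspose_mul_mul U hA
    rw [hf _ hB, hf A hA, eigVec_conjTranspose_mul_mul hA hU hB]
end

section
/- If f is a symmetric norm on ℝ^n, then the function A ↦ f(λ(A)) defines a weakly unitarily invariant norm on H_n (in particular it is positive definite, absolutely homogeneous, and satisfies the triangle inequality on H_n). -/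
open MeasureTheory ProbabilityTheory Matrix

/-- A symmetric norm does not increase under the action of a doubly stochastic matrix. -/
theorem IsSymmetricNorm.apply_mulVec_le {n : ℕ} {f : (Fin n → ℝ) → ℝ} (hf : IsSymmetricNorm f)
    {S : Matrix (Fin n) (Fin n) ℝ} (hS : S ∈ doublyStochastic ℝ (Fin n)) (x : Fin n → ℝ) :
    f (S *ᵥ x) ≤ f x := by
  obtain ⟨h0, hsmul, hadd, hperm⟩ := hf
  obtain ⟨w, hw0, hw1, rfl⟩ := exists_eq_sum_perm_of_mem_doublyStochastic hS
  rw [Matrix.sum_mulVec]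
  calc f (∑ σ, (w σ • σ.permMatrix ℝ) *ᵥ x)
      ≤ ∑ σ, f ((w σ • σ.permMatrix ℝ) *ᵥ x) :=
        Finset.le_sum_of_subadditive f ((h0 0).2 rfl).le hadd _ _
    _ = ∑ σ, w σ * f x := by
        refine Finset.sum_congr rfl fun σ _ => ?_
        rw [Matrix.smul_mulVec, hsmul, abs_of_nonneg (hw0 σ), Matrix.permMatrix_mulVec, hperm]
    _ = f x := by rw [← Finset.sum_mul, hw1, one_mul]

/-- The squared moduli of the entries of a unitary matrix form a doubly stochastic matrix. -/
theorem normSq_mem_doublyStochastic {m : Type*} [Fintype m] [DecidableEq m] {U : Matrix m m ℂ}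
    (hU : U ∈ Matrix.unitaryGroup m ℂ) :
    Matrix.of (fun i j => Complex.normSq (U i j)) ∈ doublyStochastic ℝ m := by
  rw [mem_doublyStochastic_iff_sum]
  refine ⟨fun i j => Complex.normSq_nonneg _, fun i => ?_, fun j => ?_⟩
  · have h := congrFun (congrFun (Matrix.mem_unitaryGroup_iff.1 hU) i) i
    apply Complex.ofReal_injective
    simpa [Matrix.mul_apply, Matrix.star_apply, Complex.mul_conj] using h
  · have h := congrFun (congrFun (Matrix.mem_unitaryGroup_iff'.1 hU) j) j
    apply Complex.ofReal_injective
    simpa [Matrix.mul_apply, Matrix.star_apply, Complex.normSq_eq_conj_mul_self] using h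

/-- The real parts of the diagonal entries of `Uᴴ * A * U`. -/
noncomputable def conjDiag {n : ℕ} (U A : Matrix (Fin n) (Fin n) ℂ) : Fin n → ℝ :=
  fun i => ((Uᴴ * A * U) i i).re

theorem conjDiag_add {n : ℕ} (U A B : Matrix (Fin n) (Fin n) ℂ) :
    conjDiag U (A + B) = conjDiag U A + conjDiag U B := by
  ext i
  simp [conjDiag, Matrix.mul_add, Matrix.add_mul]

theorem conjDiag_smul {n : ℕ} (c : ℝ) (U A : Matrix (Fin n) (Fin n) ℂ) :
    conjDiag U (c • A) = c • conjDiag U A := by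
  ext i
  simp [conjDiag]

theorem conjDiag_eigenvectorUnitary {n : ℕ} {A : Matrix (Fin n) (Fin n) ℂ}
    (hA : A.IsHermitian) :
    conjDiag (hA.eigenvectorUnitary : Matrix (Fin n) (Fin n) ℂ) A = hA.eigenvalues := by
  have h := hA.conjStarAlgAut_star_eigenvectorUnitary
  rw [Unitary.conjStarAlgAut_apply] at h
  ext i
  have h' := congrArg Complex.re (congrFun (congrFun h i) i)
  simpa [conjDiag, Matrix.star_eq_conjTranspose] using h'

/-- The diagonal of a unitary conjugate of `A` is the image of the eigenvalues of `A` under a doubly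
stochastic matrix. -/
theorem conjDiag_eq_mulVec_eigenvalues {n : ℕ} {A U : Matrix (Fin n) (Fin n) ℂ}
    (hA : A.IsHermitian) :
    conjDiag U A = Matrix.of (fun i j => Complex.normSq
      ((Uᴴ * (hA.eigenvectorUnitary : Matrix (Fin n) (Fin n) ℂ)) i j)) *ᵥ hA.eigenvalues := by
  set W := (hA.eigenvectorUnitary : Matrix (Fin n) (Fin n) ℂ)
  set V := Uᴴ * W with hV
  have h : Uᴴ * A * U = V * Matrix.diagonal (fun i => (hA.eigenvalues i : ℂ)) * Vᴴ := by
    conv_lhs => rw [hA.spectral_theorem, Unitary.conjStarAlgAut_apply]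
    simp only [hV, Matrix.conjTranspose_mul, Matrix.conjTranspose_conjTranspose,
      Matrix.star_eq_conjTranspose, Matrix.mul_assoc]
    rfl
  ext i
  rw [conjDiag, h, Matrix.mul_apply, Complex.re_sum]
  refine Finset.sum_congr rfl fun j _ => ?_
  simp [Matrix.mul_diagonal, Complex.normSq_apply]
  ring

theorem IsSymmetricNorm.apply_conjDiag_le {n : ℕ} {f : (Fin n → ℝ) → ℝ} (hf : IsSymmetricNorm f)
    {A U : Matrix (Fin n) (Fin n) ℂ} (hA : A.IsHermitian)
    (hU : U ∈ Matrix.unitaryGroup (Fin n) ℂ) :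
    f (conjDiag U A) ≤ f hA.eigenvalues := by
  rw [conjDiag_eq_mulVec_eigenvalues hA]
  exact hf.apply_mulVec_le
    (normSq_mem_doublyStochastic (mul_mem (Unitary.star_mem hU) hA.eigenvectorUnitary.2)) _

theorem IsSymmetricNorm.apply_eigVec {n : ℕ} {f : (Fin n → ℝ) → ℝ} (hf : IsSymmetricNorm f)
    {A : Matrix (Fin n) (Fin n) ℂ} (hA : A.IsHermitian) :
    f (eigVec hA) = f hA.eigenvalues :=
  hf.2.2.2 (Fin.revPerm.trans (Tuple.sort hA.eigenvalues)) hA.eigenvalues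

/-- If `f` is a symmetric norm on `ℝⁿ`, then `A ↦ f(λ(A))` defines a weakly unitarily
invariant norm on the Hermitian matrices. -/
theorem symmetricNorm_eigenvalues_isNormOnHermitian
    {n : ℕ} (f : (Fin n → ℝ) → ℝ) (hf : IsSymmetricNorm f)
    (N : Matrix (Fin n) (Fin n) ℂ → ℝ)
    (hN : ∀ (A : Matrix (Fin n) (Fin n) ℂ) (hA : A.IsHermitian), N A = f (eigVec hA)) :
    IsNormOnHermitian N ∧ IsWeaklyUnitarilyInvariant N := by
  have hN' : ∀ (A : Matrix (Fin n) (Fin n) ℂ) (hA : A.IsHermitian), N A = f hA.eigenvalues :=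
    fun A hA => (hN A hA).trans (hf.apply_eigVec hA)
  refine ⟨⟨fun A hA => ?_, fun c A hA => ?_, fun A B hA hB => ?_⟩, fun A hA U hU => ?_⟩
  · rw [hN' A hA, hf.1, hA.eigenvalues_eq_zero_iff]
  · have hcA : (c • A).IsHermitian := hA.smul (IsSelfAdjoint.all c)
    rw [hN' _ hcA, hN' A hA]
    apply le_antisymm
    · rw [← conjDiag_eigenvectorUnitary hcA, conjDiag_smul, hf.2.1]
      exact mul_le_mul_of_nonneg_left (hf.apply_conjDiag_le hA hcA.eigenvectorUnitary.2)
        (abs_nonneg c)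
    · rw [← conjDiag_eigenvectorUnitary hA, ← hf.2.1, ← conjDiag_smul]
      exact hf.apply_conjDiag_le hcA hA.eigenvectorUnitary.2
  · have hAB : (A + B).IsHermitian := hA.add hB
    rw [hN' _ hAB, hN' A hA, hN' B hB, ← conjDiag_eigenvectorUnitary hAB, conjDiag_add]
    exact (hf.2.2.1 _ _).trans (add_le_add
      (hf.apply_conjDiag_le hA hAB.eigenvectorUnitary.2)
      (hf.apply_conjDiag_le hB hAB.eigenvectorUnitary.2))
  · have hUA : (Uᴴ * A * U).IsHermitian := Matrix.isHermitian_conjTranspose_mul_mul U hA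
    have hchar : (Uᴴ * A * U).charpoly = A.charpoly := by
      rw [Matrix.charpoly_mul_comm, ← Matrix.mul_assoc, ← Matrix.star_eq_conjTranspose,
        Matrix.mem_unitaryGroup_iff.1 hU, Matrix.one_mul]
    rw [hN' _ hUA, hN' A hA, (hUA.eigenvalues_eq_eigenvalues_iff hA).2 hchar]
end

section
/- For any two n×n complex Hermitian matrices A and B, the eigenvalue vector λ(A+B) is majorized by λ(A) + λ(B); that is, for every 1 ≤ k ≤ n the sum of the k largest entries of λ(A+B) is at most the sum of the k largest entries of λ(A) + λ(B), with equality when k = n. -/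
open MeasureTheory ProbabilityTheory Matrix

/-- The entries of `x : ℝⁿ` rearranged in nonincreasing order. -/
noncomputable def descSort {n : ℕ} (x : Fin n → ℝ) : Fin n → ℝ :=
  fun i => x (Tuple.sort x i.rev)

/-- The sum of the `k` largest entries of `x : ℝⁿ`. -/
noncomputable def sumKLargest {n : ℕ} (x : Fin n → ℝ) (k : ℕ) : ℝ :=
  ∑ i ∈ Finset.univ.filter (fun i : Fin n => (i : ℕ) < k), descSort x i

theorem antitone_descSort {n : ℕ} (x : Fin n → ℝ) : Antitone (descSort x) := fun _ _ h =>
  Tuple.monotone_sort x (Fin.rev_le_rev.mpr h)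

/-- The permutation that puts the entries of `x` in nonincreasing order. -/
noncomputable def descPerm {n : ℕ} (x : Fin n → ℝ) : Equiv.Perm (Fin n) :=
  Fin.revPerm.trans (Tuple.sort x)

theorem descSort_apply {n : ℕ} (x : Fin n → ℝ) (i : Fin n) : descSort x i = x (descPerm x i) :=
  rfl

theorem eigVec_eq_descSort {n : ℕ} {A : Matrix (Fin n) (Fin n) ℂ} (hA : A.IsHermitian) :
    eigVec hA = descSort hA.eigenvalues :=
  rfl

theorem sum_descSort {n : ℕ} (x : Fin n → ℝ) : ∑ i, descSort x i = ∑ i, x i :=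
  Equiv.sum_comp (descPerm x) x

theorem card_filter_val_lt {n k : ℕ} (hk : k ≤ n) :
    (Finset.univ.filter (fun i : Fin n => (i : ℕ) < k)).card = k := by
  rw [Fin.card_filter_val_lt, min_eq_right hk]

/-- A weighted sum with weights in `[0, 1]` of total `k` is at most the sum of the `k` largest
entries. -/
theorem sum_mul_le_sumKLargest {n k : ℕ} (hk : k ≤ n) (x w : Fin n → ℝ)
    (h0 : ∀ i, 0 ≤ w i) (h1 : ∀ i, w i ≤ 1) (hw : ∑ i, w i = k) :
    ∑ i, w i * x i ≤ sumKLargest x k := by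
  rcases Nat.eq_zero_or_pos k with rfl | hpos
  · have hz : ∀ i, w i = 0 := fun i =>
      (Finset.sum_eq_zero_iff_of_nonneg fun i _ => h0 i).mp (by simpa using hw) i
        (Finset.mem_univ i)
    simp [hz, sumKLargest]
  set t : ℝ := descSort x ⟨k - 1, by omega⟩ with ht
  have hind : ∑ i : Fin n, (if (i : ℕ) < k then (1 : ℝ) else 0) = k := by
    rw [Finset.sum_boole, card_filter_val_lt hk]
  have hw' : ∑ i, w (descPerm x i) = k := by rw [Equiv.sum_comp (descPerm x) w, hw]
  have hterm : ∑ i, w (descPerm x i) * (descSort x i - t) ≤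
      ∑ i : Fin n, (if (i : ℕ) < k then (1 : ℝ) else 0) * (descSort x i - t) := by
    refine Finset.sum_le_sum fun i _ => ?_
    split_ifs with hi
    · exact mul_le_mul_of_nonneg_right (h1 _)
        (sub_nonneg.mpr (antitone_descSort x (Fin.le_def.mpr (by simp only; omega))))
    · rw [zero_mul]
      exact mul_nonpos_of_nonneg_of_nonpos (h0 _)
        (sub_nonpos.mpr (antitone_descSort x (Fin.le_def.mpr (by simp only; omega))))
  simp only [mul_sub, Finset.sum_sub_distrib, ← Finset.sum_mul, hw', hind] at hterm
  rw [← Equiv.sum_comp (descPerm x) (fun i => w i * x i), sumKLargest, Finset.sum_filter]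
  simpa [descSort_apply] using hterm

theorem sum_le_sumKLargest {n : ℕ} (x : Fin n → ℝ) (s : Finset (Fin n)) :
    ∑ i ∈ s, x i ≤ sumKLargest x s.card := by
  have h := sum_mul_le_sumKLargest (s.card_le_univ.trans_eq (Fintype.card_fin n)) x
    (fun i => if i ∈ s then 1 else 0) (fun i => by split_ifs <;> norm_num)
    (fun i => by split_ifs <;> norm_num) (by simp)
  simpa using h

theorem exists_sum_eq_sumKLargest {n k : ℕ} (hk : k ≤ n) (x : Fin n → ℝ) :
    ∃ s : Finset (Fin n), s.card = k ∧ sumKLargest x k = ∑ i ∈ s, x i :=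
  ⟨(Finset.univ.filter (fun i : Fin n => (i : ℕ) < k)).map (descPerm x).toEmbedding,
    by rw [Finset.card_map, card_filter_val_lt hk], by rw [Finset.sum_map]; rfl⟩

theorem sumKLargest_self {n : ℕ} (x : Fin n → ℝ) : sumKLargest x n = ∑ i, x i := by
  simp [sumKLargest, sum_descSort]

theorem sum_normSq_row {n : ℕ} {W : Matrix (Fin n) (Fin n) ℂ}
    (hW : W ∈ unitaryGroup (Fin n) ℂ) (i : Fin n) : ∑ j, Complex.normSq (W i j) = 1 := by
  have h := congr_fun₂ (mem_unitaryGroup_iff.mp hW) i i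
  simp only [mul_apply, star_apply, RCLike.star_def, Complex.mul_conj, one_apply_eq] at h
  exact_mod_cast h

theorem sum_normSq_col {n : ℕ} {W : Matrix (Fin n) (Fin n) ℂ}
    (hW : W ∈ unitaryGroup (Fin n) ℂ) (j : Fin n) : ∑ i, Complex.normSq (W i j) = 1 := by
  simpa [star_apply] using sum_normSq_row (Unitary.star_mem hW) j

/-- The diagonal entries of a Hermitian matrix in an orthonormal basis are averages of the
eigenvalues. -/
theorem re_diag_conj_eq {n : ℕ} {A : Matrix (Fin n) (Fin n) ℂ} (hA : A.IsHermitian)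
    (U : Matrix (Fin n) (Fin n) ℂ) (i : Fin n) :
    ((star U * A * U) i i).re =
      ∑ j, Complex.normSq ((star U * (hA.eigenvectorUnitary : Matrix (Fin n) (Fin n) ℂ)) i j) *
        hA.eigenvalues j := by
  set V := (hA.eigenvectorUnitary : Matrix (Fin n) (Fin n) ℂ)
  have hspec : A = V * diagonal (RCLike.ofReal ∘ hA.eigenvalues) * star V := by
    simpa [Unitary.conjStarAlgAut_apply] using hA.spectral_theorem
  have hconj : star U * A * U =
      (star U * V) * diagonal (RCLike.ofReal ∘ hA.eigenvalues) * star (star U * V) := by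
    conv_lhs => rw [hspec]
    simp only [star_mul, star_star, Matrix.mul_assoc]
  rw [hconj, mul_apply, Complex.re_sum]
  refine Finset.sum_congr rfl fun j _ => ?_
  rw [mul_diagonal, star_apply, RCLike.star_def, mul_right_comm, Complex.mul_conj]
  simp

/-- **Ky Fan's maximum principle**, upper bound. -/
theorem sum_re_diag_conj_le {n : ℕ} {A : Matrix (Fin n) (Fin n) ℂ} (hA : A.IsHermitian)
    {U : Matrix (Fin n) (Fin n) ℂ} (hU : U ∈ unitaryGroup (Fin n) ℂ) (s : Finset (Fin n)) :
    ∑ i ∈ s, ((star U * A * U) i i).re ≤ sumKLargest hA.eigenvalues s.card := by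
  have hW := mul_mem (Unitary.star_mem hU) hA.eigenvectorUnitary.2
  simp only [re_diag_conj_eq hA]
  rw [Finset.sum_comm]
  simp only [← Finset.sum_mul]
  refine sum_mul_le_sumKLargest (s.card_le_univ.trans_eq (Fintype.card_fin n)) _ _
    (fun j => Finset.sum_nonneg fun i _ => Complex.normSq_nonneg _) (fun j => ?_) ?_
  · rw [← sum_normSq_col hW j]
    exact Finset.sum_le_univ_sum_of_nonneg fun i => Complex.normSq_nonneg _
  · rw [Finset.sum_comm]
    simp [sum_normSq_row hW]

theorem eigenvalues_eq_re_diag_conj {n : ℕ} {A : Matrix (Fin n) (Fin n) ℂ} (hA : A.IsHermitian)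
    (i : Fin n) :
    hA.eigenvalues i = ((star (hA.eigenvectorUnitary : Matrix (Fin n) (Fin n) ℂ) * A *
      (hA.eigenvectorUnitary : Matrix (Fin n) (Fin n) ℂ)) i i).re := by
  rw [re_diag_conj_eq hA, mem_unitaryGroup_iff'.mp hA.eigenvectorUnitary.2]
  simp [one_apply, apply_ite Complex.normSq]

theorem sum_eigVec {n : ℕ} {A : Matrix (Fin n) (Fin n) ℂ} (hA : A.IsHermitian) :
    ∑ i, eigVec hA i = A.trace.re := by
  rw [eigVec_eq_descSort, sum_descSort, hA.trace_eq_sum_eigenvalues]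
  simp

/-- For Hermitian `A` and `B`, the eigenvalue vector `λ(A+B)` is majorized by `λ(A) + λ(B)`:
for every `1 ≤ k ≤ n` the sum of the `k` largest entries of `λ(A+B)` is at most the sum of the
`k` largest entries of `λ(A) + λ(B)`, with equality when `k = n`. -/
theorem eigVec_add_majorized {n : ℕ} {A B : Matrix (Fin n) (Fin n) ℂ}
    (hA : A.IsHermitian) (hB : B.IsHermitian) (hAB : (A + B).IsHermitian) :
    (∀ k : ℕ, 1 ≤ k → k ≤ n →
      sumKLargest (eigVec hAB) k ≤ sumKLargest (eigVec hA + eigVec hB) k) ∧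
    sumKLargest (eigVec hAB) n = sumKLargest (eigVec hA + eigVec hB) n := by
  refine ⟨fun k _ hk => ?_, ?_⟩
  · obtain ⟨s, hs, hsum⟩ := exists_sum_eq_sumKLargest hk (eigVec hAB)
    have hU := hAB.eigenvectorUnitary.2
    set t := s.map (descPerm hAB.eigenvalues).toEmbedding with ht
    have htk : t.card = k := by rw [ht, Finset.card_map, hs]
    calc sumKLargest (eigVec hAB) k
        = ∑ i ∈ t, hAB.eigenvalues i := by rw [hsum, ht, Finset.sum_map]; rfl
      _ ≤ sumKLargest hA.eigenvalues t.card + sumKLargest hB.eigenvalues t.card := by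
        refine le_of_eq_of_le ?_
          (add_le_add (sum_re_diag_conj_le hA hU t) (sum_re_diag_conj_le hB hU t))
        rw [← Finset.sum_add_distrib]
        refine Finset.sum_congr rfl fun i _ => ?_
        rw [eigenvalues_eq_re_diag_conj hAB, Matrix.mul_add, Matrix.add_mul, Matrix.add_apply,
          Complex.add_re]
      _ = ∑ i ∈ Finset.univ.filter (fun i : Fin n => (i : ℕ) < k),
            (eigVec hA + eigVec hB) i := by
        rw [htk]
        exact Finset.sum_add_distrib.symm
      _ ≤ sumKLargest (eigVec hA + eigVec hB) k := by
        simpa only [card_filter_val_lt hk] using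
          sum_le_sumKLargest (eigVec hA + eigVec hB)
            (Finset.univ.filter (fun i : Fin n => (i : ℕ) < k))
  · simp only [sumKLargest_self, Pi.add_apply, Finset.sum_add_distrib, sum_eigVec, trace_add,
      Complex.add_re]
end
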